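/- There exists an optimal solution of the two-hop inner problem whose source rate sequence is monotonically increasing: there is a pair (r, r̃) attaining the maximum of ∑_{i=1}^N r̃_i over all pairs feasible for the inner problem such that r_1 ≤ r_2 ≤ ⋯ ≤ r_N. -/

import Mathlib

open Finset

/-- Feasibility of a pair (source rates `r`, relay rates `rt`) for the two-hop inner
problem with source energies `E`, relay energies `Et`, destination energies `Ebar`,
relay decoding power strategy `δ`, rate-to-power function `f` and decoding cost `φ`. -/
def InnerFeasible (N : ℕ) (E Et Ebar δ : ℕ → ℝ) (f φ : ℝ → ℝ) (r rt : ℕ → ℝ) : Prop :=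
  (∀ i ∈ Finset.Icc 1 N, 0 ≤ r i) ∧
  (∀ i ∈ Finset.Icc 1 N, 0 ≤ rt i) ∧
  (∀ k ∈ Finset.Icc 1 N,
      ∑ i ∈ Finset.Icc 1 k, f (r i) ≤ ∑ i ∈ Finset.Icc 1 k, E i) ∧
  (∀ k ∈ Finset.Icc 1 N,
      ∑ i ∈ Finset.Icc 1 k, φ (r i) ≤ ∑ i ∈ Finset.Icc 1 k, δ i) ∧
  (∀ k ∈ Finset.Icc 1 N,
      ∑ i ∈ Finset.Icc 1 k, f (rt i) ≤ ∑ i ∈ Finset.Icc 1 k, (Et i - δ i)) ∧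
  (∀ k ∈ Finset.Icc 1 N,
      ∑ i ∈ Finset.Icc 1 k, rt i ≤ ∑ i ∈ Finset.Icc 1 k, r i) ∧
  (∀ k ∈ Finset.Icc 1 N,
      ∑ i ∈ Finset.Icc 1 k, φ (rt i) ≤ ∑ i ∈ Finset.Icc 1 k, Ebar i)

/-- Replace entries `i`, `i+1` by their average. -/
noncomputable def avgAt (i : ℕ) (r : ℕ → ℝ) : ℕ → ℝ :=
  fun j => if j = i ∨ j = i + 1 then (r i + r (i + 1)) / 2 else r j

lemma avgAt_sum (i : ℕ) (hi : 1 ≤ i) (r : ℕ → ℝ) (g : ℝ → ℝ) (k : ℕ) :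
    ∑ j ∈ Finset.Icc 1 k, g (avgAt i r j) = ∑ j ∈ Finset.Icc 1 k, g (r j)
      + (if i ≤ k then g ((r i + r (i + 1)) / 2) - g (r i) else 0)
      + (if i + 1 ≤ k then g ((r i + r (i + 1)) / 2) - g (r (i + 1)) else 0) := by
  induction k with
  | zero =>
    have h1 : ¬ i ≤ 0 := by omega
    have h2 : ¬ i + 1 ≤ 0 := by omega
    simp [h1]
  | succ k ih =>
    rw [Finset.sum_Icc_succ_top (by omega), Finset.sum_Icc_succ_top (by omega), ih]
    rcases lt_trichotomy (k + 1) i with h | h | h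
    · have h1 : ¬ i ≤ k := by omega
      have h2 : ¬ i ≤ k + 1 := by omega
      have h3 : ¬ i + 1 ≤ k := by omega
      have h4 : ¬ i + 1 ≤ k + 1 := by omega
      have h5 : ¬ (k + 1 = i ∨ k + 1 = i + 1) := by omega
      simp only [avgAt, h1, h2, h3, h4, h5, if_false]; ring
    · have h1 : ¬ i ≤ k := by omega
      have h2 : i ≤ k + 1 := by omega
      have h3 : ¬ i + 1 ≤ k := by omega
      have h4 : ¬ i + 1 ≤ k + 1 := by omega
      have h5 : (k + 1 = i ∨ k + 1 = i + 1) := by omega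
      simp only [avgAt, h1, h2, h3, h4, h5, if_false, if_true]; rw [h]; ring
    · by_cases h' : k = i
      · have h1 : i ≤ k := by omega
        have h2 : i ≤ k + 1 := by omega
        have h3 : ¬ i + 1 ≤ k := by omega
        have h4 : i + 1 ≤ k + 1 := by omega
        have h5 : (k + 1 = i ∨ k + 1 = i + 1) := by omega
        simp only [avgAt, h1, h2, h3, h4, h5, if_false, if_true]; rw [h']; ring
      · have h1 : i ≤ k := by omega
        have h2 : i ≤ k + 1 := by omega
        have h3 : i + 1 ≤ k := by omega
        have h4 : i + 1 ≤ k + 1 := by omega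
        have h5 : ¬ (k + 1 = i ∨ k + 1 = i + 1) := by omega
        simp only [avgAt, h1, h2, h3, h4, h5, if_false, if_true]; ring

lemma avgAt_sum_le (i : ℕ) (hi : 1 ≤ i) (r : ℕ → ℝ) (g : ℝ → ℝ)
    (hm : StrictMonoOn g (Set.Ici 0)) (hc : StrictConvexOn ℝ (Set.Ici 0) g)
    (h0 : 0 ≤ r (i + 1)) (hle : r (i + 1) ≤ r i) (k : ℕ) :
    ∑ j ∈ Finset.Icc 1 k, g (avgAt i r j) ≤ ∑ j ∈ Finset.Icc 1 k, g (r j) := by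
  rw [avgAt_sum i hi]
  have h1 : g ((r i + r (i + 1)) / 2) ≤ g (r i) :=
    hm.monotoneOn (by simp; linarith) (by simp; linarith) (by linarith)
  have h2 := hc.convexOn.2 (show r i ∈ Set.Ici 0 by simp; linarith)
    (show r (i + 1) ∈ Set.Ici 0 by simpa using h0)
    (show (0:ℝ) ≤ 1/2 by norm_num) (show (0:ℝ) ≤ 1/2 by norm_num) (by norm_num)
  simp only [smul_eq_mul] at h2
  have h3 : 1 / 2 * r i + 1 / 2 * r (i + 1) = (r i + r (i + 1)) / 2 := by ring
  rw [h3] at h2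
  split_ifs <;> first | linarith | omega

lemma avgAt_feasible (N : ℕ) (E Et Ebar δ : ℕ → ℝ) (f φ : ℝ → ℝ)
    (hf_mono : StrictMonoOn f (Set.Ici 0))
    (hf_conv : StrictConvexOn ℝ (Set.Ici 0) f)
    (hphi_mono : StrictMonoOn φ (Set.Ici 0))
    (hphi_conv : StrictConvexOn ℝ (Set.Ici 0) φ) (r rt : ℕ → ℝ)
    (h : InnerFeasible N E Et Ebar δ f φ r rt) (i : ℕ) (hi : 1 ≤ i) (hiN : i + 1 ≤ N)
    (hlt : r (i + 1) < r i) :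
    ∃ rt', InnerFeasible N E Et Ebar δ f φ (avgAt i r) rt' ∧
      ∑ j ∈ Finset.Icc 1 N, rt' j = ∑ j ∈ Finset.Icc 1 N, rt j ∧
      (rt' = rt ∨ rt' = avgAt i rt) := by
  obtain ⟨c1, c2, c3, c4, c5, c6, c7⟩ := h
  have m0 : i ∈ Finset.Icc 1 N := by simp; omega
  have m1 : i + 1 ∈ Finset.Icc 1 N := by simp; omega
  have p1 := c1 i m0
  have p2 := c1 _ m1
  have q1 := c2 i m0
  have q2 := c2 _ m1
  have nn : ∀ s : ℕ → ℝ, (∀ j ∈ Finset.Icc 1 N, 0 ≤ s j) →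
      ∀ j ∈ Finset.Icc 1 N, 0 ≤ avgAt i s j := by
    intro s hs j hj
    unfold avgAt
    split_ifs
    · linarith [hs i m0, hs _ m1]
    · exact hs j hj
  have d3 := fun k hk => (avgAt_sum_le i hi r f hf_mono hf_conv p2 hlt.le k).trans (c3 k hk)
  have d4 := fun k hk => (avgAt_sum_le i hi r φ hphi_mono hphi_conv p2 hlt.le k).trans (c4 k hk)
  have sr := fun k => avgAt_sum i hi r (fun x => x) k
  have st := fun k => avgAt_sum i hi rt (fun x => x) k
  by_cases hcase : ∑ j ∈ Finset.Icc 1 i, rt j ≤ ∑ j ∈ Finset.Icc 1 i, avgAt i r j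
  · refine ⟨rt, ⟨nn r c1, c2, d3, d4, c5, ?_, c7⟩, rfl, Or.inl rfl⟩
    intro k hk
    by_cases hki : k = i
    · subst hki; exact hcase
    · have := c6 k hk
      have := sr k
      rw [this]
      split_ifs <;> first | linarith | omega
  · have hle : rt (i + 1) ≤ rt i := by
      have a1 := sr i
      have a2 := c6 _ m1
      have a3 : ∑ j ∈ Finset.Icc 1 (i-1), rt j ≤ ∑ j ∈ Finset.Icc 1 (i-1), r j := by
        by_cases h1 : i = 1
        · subst h1; simp
        · exact c6 _ (by simp at *; omega)
      obtain ⟨n, rfl⟩ : ∃ n, i = n + 1 := ⟨i - 1, by omega⟩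
      simp only [Nat.add_sub_cancel] at a3
      simp only [le_refl, if_true] at a1
      rw [if_neg (by omega)] at a1
      rw [Finset.sum_Icc_succ_top (by omega), Finset.sum_Icc_succ_top (by omega)] at a2
      rw [Finset.sum_Icc_succ_top (by omega), Finset.sum_Icc_succ_top (by omega)] at a2
      rw [a1] at hcase
      rw [Finset.sum_Icc_succ_top (by omega), Finset.sum_Icc_succ_top (by omega)] at hcase
      linarith
    refine ⟨avgAt i rt, ⟨nn r c1, nn rt c2, d3, d4,
      fun k hk => (avgAt_sum_le i hi rt f hf_mono hf_conv q2 hle k).trans (c5 k hk), ?_,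
      fun k hk => (avgAt_sum_le i hi rt φ hphi_mono hphi_conv q2 hle k).trans (c7 k hk)⟩, ?_,
      Or.inr rfl⟩
    · intro k hk
      by_cases hki : k = i
      · subst hki
        have a2 := c6 _ m1
        have a3 : ∑ j ∈ Finset.Icc 1 (k-1), rt j ≤ ∑ j ∈ Finset.Icc 1 (k-1), r j := by
          by_cases h1 : k = 1
          · subst h1; simp
          · exact c6 _ (by simp at *; omega)
        have b1 := sr k
        have b2 := st k
        rw [b1, b2]
        obtain ⟨n, rfl⟩ : ∃ n, k = n + 1 := ⟨k - 1, by omega⟩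
        simp only [Nat.add_sub_cancel] at a3
        rw [Finset.sum_Icc_succ_top (by omega), Finset.sum_Icc_succ_top (by omega)] at a2
        rw [Finset.sum_Icc_succ_top (by omega), Finset.sum_Icc_succ_top (by omega)] at a2
        rw [Finset.sum_Icc_succ_top (by omega), Finset.sum_Icc_succ_top (by omega)]
        simp only [le_refl, if_true]
        rw [if_neg (by omega), if_neg (by omega)]
        linarith
      · have := c6 k hk
        have b1 := sr k
        have b2 := st k
        rw [b1, b2]
        split_ifs <;> first | linarith | omega
    · have b2 := st N
      rw [b2, if_pos (by omega), if_pos (by omega)]; ring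

lemma feasible_congr (N : ℕ) (E Et Ebar δ : ℕ → ℝ) (f φ f' φ' : ℝ → ℝ) (r rt r' rt' : ℕ → ℝ)
    (hf : ∀ x, 0 ≤ x → f' x = f x) (hφ : ∀ x, 0 ≤ x → φ' x = φ x)
    (hr : ∀ i ∈ Finset.Icc 1 N, r' i = r i) (hrt : ∀ i ∈ Finset.Icc 1 N, rt' i = rt i)
    (h : InnerFeasible N E Et Ebar δ f φ r rt) : InnerFeasible N E Et Ebar δ f' φ' r' rt' := by
  obtain ⟨c1, c2, c3, c4, c5, c6, c7⟩ := h
  have key : ∀ (g g' : ℝ → ℝ) (s s' : ℕ → ℝ), (∀ i ∈ Finset.Icc 1 N, g' (s' i) = g (s i)) →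
      ∀ k ∈ Finset.Icc 1 N, ∑ i ∈ Finset.Icc 1 k, g' (s' i) = ∑ i ∈ Finset.Icc 1 k, g (s i) := by
    intro g g' s s' hs k hk
    refine Finset.sum_congr rfl fun i hi => hs i ?_
    simp at *; omega
  refine ⟨fun i hi => by rw [hr i hi]; exact c1 i hi, fun i hi => by rw [hrt i hi]; exact c2 i hi,
    fun k hk => ?_, fun k hk => ?_, fun k hk => ?_, fun k hk => ?_, fun k hk => ?_⟩
  · rw [key f f' r r' (fun i hi => by rw [hr i hi, hf _ (c1 i hi)]) k hk]; exact c3 k hk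
  · rw [key φ φ' r r' (fun i hi => by rw [hr i hi, hφ _ (c1 i hi)]) k hk]; exact c4 k hk
  · rw [key f f' rt rt' (fun i hi => by rw [hrt i hi, hf _ (c2 i hi)]) k hk]; exact c5 k hk
  · have := key id id r r' hr k hk
    have h2 := key id id rt rt' hrt k hk
    simp only [id] at this h2
    rw [this, h2]; exact c6 k hk
  · rw [key φ φ' rt rt' (fun i hi => by rw [hrt i hi, hφ _ (c2 i hi)]) k hk]; exact c7 k hk

lemma feasible_closed (N : ℕ) (E Et Ebar δ : ℕ → ℝ) (f φ : ℝ → ℝ)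
    (hf : Continuous f) (hφ : Continuous φ) :
    IsClosed {p : (ℕ → ℝ) × (ℕ → ℝ) | InnerFeasible N E Et Ebar δ f φ p.1 p.2} := by
  unfold InnerFeasible
  simp only [Set.ofPred_and, Set.ofPred_forall]
  repeat' apply IsClosed.inter
  all_goals
    refine isClosed_iInter fun k => isClosed_iInter fun hk => isClosed_le ?_ ?_ <;> fun_prop

lemma rate_bound (f : ℝ → ℝ) (hf_mono : StrictMonoOn f (Set.Ici 0))
    (hf_conv : StrictConvexOn ℝ (Set.Ici 0) f) (hf0 : f 0 = 0) (T x : ℝ) (hx : 0 ≤ x)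
    (h : f x ≤ T) : x ≤ max 1 (T / f 1) := by
  have h1 : 0 < f 1 := by
    have := hf_mono (a := 0) (b := 1) (by simp) (by simp) (by norm_num)
    linarith
  by_cases hx1 : x ≤ 1
  · exact hx1.trans (le_max_left _ _)
  · push Not at hx1
    refine le_trans ?_ (le_max_right _ _)
    rw [le_div_iff₀ h1]
    have h2 := hf_conv.convexOn.2 (show x ∈ Set.Ici 0 by simpa using hx)
      (show (0:ℝ) ∈ Set.Ici 0 by simp) (show 0 ≤ 1/x by positivity)
      (show 0 ≤ 1 - 1/x by rw [sub_nonneg, div_le_one (by linarith)]; exact hx1.le) (by ring)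
    simp only [smul_eq_mul, mul_zero, add_zero, hf0] at h2
    rw [one_div, inv_mul_cancel₀ (by linarith), inv_mul_eq_div, le_div_iff₀ (by linarith)] at h2
    linarith

/-- there exists an optimal solution of the two-hop inner problem whose
source rate sequence is monotonically increasing. -/
theorem twohop_inner_exists_optimal_increasing_source
    (N : ℕ) (hN : 1 ≤ N)
    (E Et Ebar δ : ℕ → ℝ)
    (hE : ∀ i ∈ Finset.Icc 1 N, 0 ≤ E i)
    (hEt : ∀ i ∈ Finset.Icc 1 N, 0 ≤ Et i)
    (hEbar : ∀ i ∈ Finset.Icc 1 N, 0 ≤ Ebar i)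
    (hδ : ∀ i ∈ Finset.Icc 1 N, 0 ≤ δ i)
    (hδEt : ∀ k ∈ Finset.Icc 1 N,
        ∑ i ∈ Finset.Icc 1 k, δ i ≤ ∑ i ∈ Finset.Icc 1 k, Et i)
    (f φ : ℝ → ℝ)
    (hf_cont : ContinuousOn f (Set.Ici 0))
    (hf_mono : StrictMonoOn f (Set.Ici 0))
    (hf_conv : StrictConvexOn ℝ (Set.Ici 0) f)
    (hf_nonneg : ∀ x : ℝ, 0 ≤ x → 0 ≤ f x)
    (hf0 : f 0 = 0)
    (hphi_cont : ContinuousOn φ (Set.Ici 0))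
    (hphi_mono : StrictMonoOn φ (Set.Ici 0))
    (hphi_conv : StrictConvexOn ℝ (Set.Ici 0) φ)
    (hphi_nonneg : ∀ x : ℝ, 0 ≤ x → 0 ≤ φ x)
    (hphi0 : φ 0 = 0) :
    ∃ r rt : ℕ → ℝ,
      InnerFeasible N E Et Ebar δ f φ r rt ∧
      (∀ r' rt' : ℕ → ℝ, InnerFeasible N E Et Ebar δ f φ r' rt' →
          ∑ i ∈ Finset.Icc 1 N, rt' i ≤ ∑ i ∈ Finset.Icc 1 N, rt i) ∧
      (∀ i j : ℕ, 1 ≤ i → i ≤ j → j ≤ N → r i ≤ r j) := by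
  classical
  -- a uniform bound on rates
  set T := ∑ i ∈ Finset.Icc 1 N, E i with hT
  set B := max 1 (T / f 1) with hB
  have hB1 : 1 ≤ B := le_max_left _ _
  have hNr : (1 : ℝ) ≤ N := by exact_mod_cast hN
  set M := (N : ℝ) * B with hM
  have hBM : B ≤ M := by nlinarith
  set F : ℝ → ℝ := fun x => f (max x 0) with hF
  set P : ℝ → ℝ := fun x => φ (max x 0) with hP
  have hFc : Continuous F :=
    hf_cont.comp_continuous (by fun_prop) (fun x => by simp)
  have hPc : Continuous P :=
    hphi_cont.comp_continuous (by fun_prop) (fun x => by simp)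
  have hFf : ∀ x, 0 ≤ x → F x = f x := fun x hx => by simp [hF, hx]
  have hPp : ∀ x, 0 ≤ x → P x = φ x := fun x hx => by simp [hP, hx]
  have bound : ∀ r rt, InnerFeasible N E Et Ebar δ f φ r rt → ∀ i ∈ Finset.Icc 1 N,
      (r i ≤ M ∧ rt i ≤ M) := by
    intro r rt h
    obtain ⟨c1, c2, c3, c4, c5, c6, c7⟩ := h
    have mN : N ∈ Finset.Icc 1 N := by simp; omega
    have b1 : ∀ i ∈ Finset.Icc 1 N, r i ≤ B := by
      intro i hi
      refine rate_bound f hf_mono hf_conv hf0 T _ (c1 i hi) (le_trans ?_ (c3 N mN))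
      exact Finset.single_le_sum (f := fun i => f (r i)) (fun j hj => hf_nonneg _ (c1 j hj)) hi
    intro i hi
    refine ⟨(b1 i hi).trans hBM, ?_⟩
    calc rt i ≤ ∑ j ∈ Finset.Icc 1 N, rt j := Finset.single_le_sum (fun j hj => c2 j hj) hi
      _ ≤ ∑ j ∈ Finset.Icc 1 N, r j := c6 N mN
      _ ≤ ∑ j ∈ Finset.Icc 1 N, B := Finset.sum_le_sum b1
      _ = M := by simp [hM]
  set Box : Set ((ℕ → ℝ) × (ℕ → ℝ)) :=
    (Set.univ.pi fun _ => Set.Icc 0 M) ×ˢ (Set.univ.pi fun _ => Set.Icc 0 M) with hBox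
  have hBoxc : IsCompact Box :=
    (isCompact_univ_pi fun _ => isCompact_Icc).prod (isCompact_univ_pi fun _ => isCompact_Icc)
  set K := Box ∩ {p : (ℕ → ℝ) × (ℕ → ℝ) | InnerFeasible N E Et Ebar δ F P p.1 p.2} with hK
  have hKc : IsCompact K := hBoxc.inter_right (feasible_closed N E Et Ebar δ F P hFc hPc)
  have KtoFeas : ∀ p ∈ K, InnerFeasible N E Et Ebar δ f φ p.1 p.2 := fun p hp =>
    feasible_congr N E Et Ebar δ F P f φ _ _ _ _ (fun x hx => (hFf x hx).symm)
      (fun x hx => (hPp x hx).symm) (fun _ _ => rfl) (fun _ _ => rfl) hp.2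
  set tr : (ℕ → ℝ) → (ℕ → ℝ) := fun s i => if i ∈ Finset.Icc 1 N then s i else 0 with htr
  have trs : ∀ s, ∀ i ∈ Finset.Icc 1 N, tr s i = s i := fun s i hi => by
    simp only [htr]; rw [if_pos hi]
  have FeastoK : ∀ r rt, InnerFeasible N E Et Ebar δ f φ r rt → (tr r, tr rt) ∈ K := by
    intro r rt h
    have hb := bound r rt h
    refine ⟨⟨fun i _ => ?_, fun i _ => ?_⟩, feasible_congr N E Et Ebar δ f φ F P _ _ _ _ hFf hPp
      (trs r) (trs rt) h⟩
    · simp only [htr]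
      split_ifs with hi
      · exact ⟨h.1 i hi, (hb i hi).1⟩
      · exact ⟨le_refl _, by linarith⟩
    · simp only [htr]
      split_ifs with hi
      · exact ⟨h.2.1 i hi, (hb i hi).2⟩
      · exact ⟨le_refl _, by linarith⟩
  have sub : ∀ k ∈ Finset.Icc 1 N, ∀ i ∈ Finset.Icc 1 k, i ∈ Finset.Icc 1 N := by
    intro k hk i hi; simp at *; omega
  have hzero : InnerFeasible N E Et Ebar δ f φ (fun _ => 0) (fun _ => 0) := by
    refine ⟨fun _ _ => le_refl _, fun _ _ => le_refl _, fun k hk => ?_, fun k hk => ?_,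
      fun k hk => ?_, fun k hk => le_refl _, fun k hk => ?_⟩
    · simp only [hf0, Finset.sum_const_zero]
      exact Finset.sum_nonneg fun i hi => hE i (sub k hk i hi)
    · simp only [hphi0, Finset.sum_const_zero]
      exact Finset.sum_nonneg fun i hi => hδ i (sub k hk i hi)
    · simp only [hf0, Finset.sum_const_zero, Finset.sum_sub_distrib]
      linarith [hδEt k hk]
    · simp only [hphi0, Finset.sum_const_zero]
      exact Finset.sum_nonneg fun i hi => hEbar i (sub k hk i hi)
  obtain ⟨p0, hp0, hmax⟩ := hKc.exists_isMaxOn ⟨_, FeastoK _ _ hzero⟩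
    (f := fun p : (ℕ → ℝ) × (ℕ → ℝ) => ∑ i ∈ Finset.Icc 1 N, p.2 i)
    (Continuous.continuousOn (by fun_prop))
  set K2 := K ∩ {p : (ℕ → ℝ) × (ℕ → ℝ) |
    ∑ i ∈ Finset.Icc 1 N, p.2 i = ∑ i ∈ Finset.Icc 1 N, p0.2 i} with hK2
  have hK2c : IsCompact K2 :=
    hKc.inter_right (isClosed_eq (by fun_prop) (by fun_prop))
  obtain ⟨p, hp, hmin⟩ := hK2c.exists_isMinOn ⟨p0, hp0, rfl⟩
    (f := fun p : (ℕ → ℝ) × (ℕ → ℝ) => ∑ i ∈ Finset.Icc 1 N, (p.1 i) ^ 2)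
    (Continuous.continuousOn (by fun_prop))
  have hpf := KtoFeas p hp.1
  refine ⟨p.1, p.2, hpf, ?_, ?_⟩
  · intro r' rt' h
    have h1 := hmax (FeastoK r' rt' h)
    simp only [Set.mem_ofPred_eq] at h1
    rw [Finset.sum_congr rfl (trs rt')] at h1
    exact h1.trans_eq hp.2.symm
  · have adj : ∀ i, 1 ≤ i → i + 1 ≤ N → p.1 i ≤ p.1 (i + 1) := by
      intro i hi hiN
      by_contra hlt
      push Not at hlt
      obtain ⟨rt', hfeas, hsum, -⟩ := avgAt_feasible N E Et Ebar δ f φ hf_mono hf_conv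
        hphi_mono hphi_conv p.1 p.2 hpf i hi hiN hlt
      have hk := FeastoK _ _ hfeas
      have hk2 : (tr (avgAt i p.1), tr rt') ∈ K2 := by
        refine ⟨hk, ?_⟩
        simp only [Set.mem_ofPred_eq]
        rw [Finset.sum_congr rfl (trs rt'), hsum]
        exact hp.2
      have h1 := hmin hk2
      simp only [Set.mem_ofPred_eq] at h1
      have h3 : ∑ j ∈ Finset.Icc 1 N, tr (avgAt i p.1) j ^ 2
          = ∑ j ∈ Finset.Icc 1 N, avgAt i p.1 j ^ 2 :=
        Finset.sum_congr rfl (fun j hj => by rw [trs (avgAt i p.1) j hj])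
      rw [h3] at h1
      have h2 := avgAt_sum i hi p.1 (fun x => x ^ 2) N
      rw [h2, if_pos (by omega), if_pos hiN] at h1
      nlinarith [mul_pos (sub_pos.2 hlt) (sub_pos.2 hlt)]
    intro i j hi hij
    induction j, hij using Nat.le_induction with
    | base => intro _; exact le_refl _
    | succ n hn ih => intro hnN; exact (ih (by omega)).trans (adj n (by omega) hnN)
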